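/- Let a > 0 and c ≠ 0 be real numbers. Then the function v(x,t) = −2c / (e^{2ax − 8a³t} + (c²/(4a²)) e^{−2ax + 8a³t}) is well defined on all of ℝ² and satisfies the focusing modified Korteweg–de Vries equation v_t + v_{xxx} + 6v²v_x = 0 at every point (x,t) of the real plane. -/

import Mathlib

open Matrix MeasureTheory Filter

noncomputable def mexp {p : ℕ} (M : Matrix (Fin p) (Fin p) ℝ) : Matrix (Fin p) (Fin p) ℝ :=
  ∑' k : ℕ, (k.factorial : ℝ)⁻¹ • M ^ k

def EigPos {p : ℕ} (A : Matrix (Fin p) (Fin p) ℝ) : Prop :=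
  ∀ μ ∈ spectrum ℂ (A.map Complex.ofReal), 0 < μ.re

def Observable {p : ℕ} (A : Matrix (Fin p) (Fin p) ℝ) (C : Matrix (Fin 1) (Fin p) ℝ) : Prop :=
  ∀ v : Fin p → ℝ, (∀ r : ℕ, (C * A ^ r) *ᵥ v = 0) → v = 0

def Controllable {p : ℕ} (A : Matrix (Fin p) (Fin p) ℝ) (B : Matrix (Fin p) (Fin 1) ℝ) : Prop :=
  ∀ v : Fin p → ℝ, (∀ r : ℕ, (Bᵀ * Aᵀ ^ r) *ᵥ v = 0) → v = 0

noncomputable def Qmat {p : ℕ} (A : Matrix (Fin p) (Fin p) ℝ) (C : Matrix (Fin 1) (Fin p) ℝ) :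
    Matrix (Fin p) (Fin p) ℝ :=
  Matrix.of fun i j =>
    ∫ s in Set.Ioi (0 : ℝ), (mexp (-(s • Aᵀ)) * (Cᵀ * C) * mexp (-(s • A))) i j

noncomputable def Nmat {p : ℕ} (A : Matrix (Fin p) (Fin p) ℝ) (B : Matrix (Fin p) (Fin 1) ℝ) :
    Matrix (Fin p) (Fin p) ℝ :=
  Matrix.of fun i j =>
    ∫ s in Set.Ioi (0 : ℝ), (mexp (-(s • A)) * (B * Bᵀ) * mexp (-(s • Aᵀ))) i j

noncomputable def Pmat {p : ℕ} (A : Matrix (Fin p) (Fin p) ℝ) (B : Matrix (Fin p) (Fin 1) ℝ)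
    (C : Matrix (Fin 1) (Fin p) ℝ) : Matrix (Fin p) (Fin p) ℝ :=
  Matrix.of fun i j =>
    ∫ s in Set.Ioi (0 : ℝ), (mexp (-(s • A)) * (B * C) * mexp (-(s • A))) i j

noncomputable def Fmat {p : ℕ} (A : Matrix (Fin p) (Fin p) ℝ) (B : Matrix (Fin p) (Fin 1) ℝ)
    (C : Matrix (Fin 1) (Fin p) ℝ) (x t : ℝ) : Matrix (Fin p) (Fin p) ℝ :=
  mexp ((2 * x) • Aᵀ - (8 * t) • Aᵀ ^ 3) +
    Qmat A C * mexp (-((2 * x) • A) + (8 * t) • A ^ 3) * Nmat A B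

noncomputable def Emat {p : ℕ} (A : Matrix (Fin p) (Fin p) ℝ) (B : Matrix (Fin p) (Fin 1) ℝ)
    (C : Matrix (Fin 1) (Fin p) ℝ) (x t : ℝ) : Matrix (Fin p) (Fin p) ℝ :=
  mexp ((2 * x) • A - (8 * t) • A ^ 3) +
    Pmat A B C * mexp (-((2 * x) • A) + (8 * t) • A ^ 3) * Pmat A B C

noncomputable def uFun {p : ℕ} (A : Matrix (Fin p) (Fin p) ℝ) (B : Matrix (Fin p) (Fin 1) ℝ)
    (C : Matrix (Fin 1) (Fin p) ℝ) (x t : ℝ) : ℝ :=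
  -2 * ((Bᵀ * (Fmat A B C x t)⁻¹ * Cᵀ : Matrix (Fin 1) (Fin 1) ℝ) 0 0)

noncomputable def vFun {p : ℕ} (A : Matrix (Fin p) (Fin p) ℝ) (B : Matrix (Fin p) (Fin 1) ℝ)
    (C : Matrix (Fin 1) (Fin p) ℝ) (x t : ℝ) : ℝ :=
  -2 * ((C * (Emat A B C x t)⁻¹ * B : Matrix (Fin 1) (Fin 1) ℝ) 0 0)

noncomputable def calQ {p : ℕ} (A : Matrix (Fin p) (Fin p) ℝ) (C : Matrix (Fin 1) (Fin p) ℝ)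
    (x t : ℝ) : Matrix (Fin p) (Fin p) ℝ :=
  mexp (-(x • Aᵀ)) * mexp ((8 * t) • Aᵀ ^ 3) * Qmat A C * mexp (-(x • A)) * mexp ((8 * t) • A ^ 3)

noncomputable def calN {p : ℕ} (A : Matrix (Fin p) (Fin p) ℝ) (B : Matrix (Fin p) (Fin 1) ℝ)
    (x : ℝ) : Matrix (Fin p) (Fin p) ℝ :=
  mexp (-(x • A)) * Nmat A B * mexp (-(x • Aᵀ))

noncomputable def Gam {p : ℕ} (A : Matrix (Fin p) (Fin p) ℝ) (B : Matrix (Fin p) (Fin 1) ℝ)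
    (C : Matrix (Fin 1) (Fin p) ℝ) (x t : ℝ) : Matrix (Fin p) (Fin p) ℝ :=
  1 + calQ A C x t * calN A B x

noncomputable def Om {p : ℕ} (A : Matrix (Fin p) (Fin p) ℝ) (B : Matrix (Fin p) (Fin 1) ℝ)
    (C : Matrix (Fin 1) (Fin p) ℝ) (w t : ℝ) : ℝ :=
  ((C * mexp (-(w • A)) * mexp ((8 * t) • A ^ 3) * B : Matrix (Fin 1) (Fin 1) ℝ) 0 0)

noncomputable def Kker {p : ℕ} (A : Matrix (Fin p) (Fin p) ℝ) (B : Matrix (Fin p) (Fin 1) ℝ)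
    (C : Matrix (Fin 1) (Fin p) ℝ) (x y t : ℝ) : ℝ :=
  ((Bᵀ * (Fmat A B C x t)⁻¹ * mexp (-((y - x) • Aᵀ)) * Cᵀ : Matrix (Fin 1) (Fin 1) ℝ) 0 0)

noncomputable def solitonV (a c x t : ℝ) : ℝ :=
  -2 * c / (Real.exp (2 * a * x - 8 * a ^ 3 * t)
    + (c ^ 2 / (4 * a ^ 2)) * Real.exp (-(2 * a * x) + 8 * a ^ 3 * t))

noncomputable def sD (a k x t : ℝ) : ℝ :=
  Real.exp (2 * a * x - 8 * a ^ 3 * t) + k * Real.exp (-(2 * a * x) + 8 * a ^ 3 * t)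

noncomputable def sS (a k x t : ℝ) : ℝ :=
  Real.exp (2 * a * x - 8 * a ^ 3 * t) - k * Real.exp (-(2 * a * x) + 8 * a ^ 3 * t)

lemma sD_pos (a k x t : ℝ) (hk : 0 ≤ k) : 0 < sD a k x t := by
  unfold sD; positivity

lemma sS_sq (a k x t : ℝ) : sS a k x t ^ 2 = sD a k x t ^ 2 - 4 * k := by
  have h : Real.exp (2 * a * x - 8 * a ^ 3 * t) * Real.exp (-(2 * a * x) + 8 * a ^ 3 * t) = 1 := by
    rw [← Real.exp_add, ← Real.exp_zero]; congr 1; ring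
  unfold sS sD
  linear_combination (-4 * k) * h

lemma th_x (a x t : ℝ) : HasDerivAt (fun ξ : ℝ => 2 * a * ξ - 8 * a ^ 3 * t) (2 * a) x := by
  simpa using ((hasDerivAt_id x).const_mul (2 * a)).sub_const (8 * a ^ 3 * t)

lemma th_x2 (a x t : ℝ) : HasDerivAt (fun ξ : ℝ => -(2 * a * ξ) + 8 * a ^ 3 * t) (-(2 * a)) x := by
  simpa using (((hasDerivAt_id x).const_mul (2 * a)).neg).add_const (8 * a ^ 3 * t)

lemma th_t (a x t : ℝ) : HasDerivAt (fun τ : ℝ => 2 * a * x - 8 * a ^ 3 * τ) (-(8 * a ^ 3)) t := by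
  simpa using ((hasDerivAt_id t).const_mul (8 * a ^ 3)).const_sub (2 * a * x)

lemma th_t2 (a x t : ℝ) : HasDerivAt (fun τ : ℝ => -(2 * a * x) + 8 * a ^ 3 * τ) (8 * a ^ 3) t := by
  simpa using ((hasDerivAt_id t).const_mul (8 * a ^ 3)).const_add (-(2 * a * x))

lemma sD_x (a k x t : ℝ) : HasDerivAt (fun ξ => sD a k ξ t) (2 * a * sS a k x t) x := by
  refine ((th_x a x t).exp.add ((th_x2 a x t).exp.const_mul k)).congr_deriv ?_
  unfold sS; ring

lemma sS_x (a k x t : ℝ) : HasDerivAt (fun ξ => sS a k ξ t) (2 * a * sD a k x t) x := by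
  refine ((th_x a x t).exp.sub ((th_x2 a x t).exp.const_mul k)).congr_deriv ?_
  unfold sD; ring

lemma sD_t (a k x t : ℝ) : HasDerivAt (fun τ => sD a k x τ) (-(8 * a ^ 3) * sS a k x t) t := by
  refine ((th_t a x t).exp.add ((th_t2 a x t).exp.const_mul k)).congr_deriv ?_
  unfold sS; ring

lemma v_d (c : ℝ) (D : ℝ → ℝ) (D' x : ℝ) (h : HasDerivAt D D' x) (h0 : D x ≠ 0) :
    HasDerivAt (fun ξ => -2 * c / D ξ) (2 * c * D' / D x ^ 2) x := by
  refine ((hasDerivAt_const x (-2 * c)).div h h0).congr_deriv ?_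
  ring

lemma v_2 (a c k x t : ℝ) (hk : 0 ≤ k) :
    HasDerivAt (fun ξ => 2 * c * (2 * a * sS a k ξ t) / sD a k ξ t ^ 2)
      (8 * a ^ 2 * c * (8 * k - sD a k x t ^ 2) / sD a k x t ^ 3) x := by
  have h0 := (sD_pos a k x t hk).ne'
  refine ((((sS_x a k x t).const_mul (2 * a)).const_mul (2 * c)).div
    ((sD_x a k x t).pow 2) (pow_ne_zero 2 h0)).congr_deriv ?_
  have hs := sS_sq a k x t
  simp only [Pi.pow_apply]
  field_simp
  push_cast
  simp
  linear_combination (-16 * c * a ^ 2 * sD a k x t) * hs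

lemma v_3 (a c k x t : ℝ) (hk : 0 ≤ k) :
    HasDerivAt (fun ξ => 8 * a ^ 2 * c * (8 * k - sD a k ξ t ^ 2) / sD a k ξ t ^ 3)
      (16 * a ^ 3 * c * sS a k x t * (sD a k x t ^ 2 - 24 * k) / sD a k x t ^ 4) x := by
  have h0 := (sD_pos a k x t hk).ne'
  refine (((((sD_x a k x t).pow 2).const_sub (8 * k)).const_mul (8 * a ^ 2 * c)).div
    ((sD_x a k x t).pow 3) (pow_ne_zero 3 h0)).congr_deriv ?_
  simp only [Pi.pow_apply]
  field_simp
  push_cast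
  ring

theorem statement19 (a c : ℝ) (ha : 0 < a) (hc : c ≠ 0) :
    ∀ x t : ℝ,
      (Real.exp (2 * a * x - 8 * a ^ 3 * t)
        + (c ^ 2 / (4 * a ^ 2)) * Real.exp (-(2 * a * x) + 8 * a ^ 3 * t)) ≠ 0 ∧
      deriv (fun τ : ℝ => solitonV a c x τ) t
        + iteratedDeriv 3 (fun ξ : ℝ => solitonV a c ξ t) x
        + 6 * (solitonV a c x t) ^ 2 * deriv (fun ξ : ℝ => solitonV a c ξ t) x = 0 := by
  intro x t
  obtain ⟨k, hkd⟩ : ∃ k, k = c ^ 2 / (4 * a ^ 2) := ⟨_, rfl⟩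
  have hk : 0 ≤ k := by rw [hkd]; positivity
  have hv : ∀ x t, solitonV a c x t = -2 * c / sD a k x t := by
    intro x t; rw [hkd]; rfl
  have h0 : ∀ x t, sD a k x t ≠ 0 := fun x t => (sD_pos a k x t hk).ne'
  refine ⟨by have := h0 x t; rw [hkd] at this; exact this, ?_⟩
  simp only [hv]
  have e1 : deriv (fun ξ => -2 * c / sD a k ξ t)
      = fun ξ => 2 * c * (2 * a * sS a k ξ t) / sD a k ξ t ^ 2 := by
    funext ξ; exact (v_d c _ _ ξ (sD_x a k ξ t) (h0 ξ t)).deriv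
  have e2 : deriv (fun ξ => 2 * c * (2 * a * sS a k ξ t) / sD a k ξ t ^ 2)
      = fun ξ => 8 * a ^ 2 * c * (8 * k - sD a k ξ t ^ 2) / sD a k ξ t ^ 3 := by
    funext ξ; exact (v_2 a c k ξ t hk).deriv
  rw [iteratedDeriv_succ, iteratedDeriv_succ, iteratedDeriv_one, e1, e2, (v_3 a c k x t hk).deriv,
    (v_d c _ _ t (sD_t a k x t) (h0 x t)).deriv]
  have h := h0 x t
  have hc2 : c ^ 2 = 4 * a ^ 2 * k := by rw [hkd]; field_simp
  field_simp
  linear_combination (96 * a * c * sS a k x t) * hc2
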